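/- Let a_1, ..., a_m be real numbers with a_u ≥ A for every u, where A > 0, and let x be a real number with Σ_{u=1}^{m} 2^{-x/a_u} = 1/2. Then for every real L with 0 ≤ L ≤ 2A, it holds that Σ_{u=1}^{m} 2^{-(x+L)/a_u} ≥ 1/8. -/

import Mathlib

/-- Let `a 1, …, a m` be reals with `a u ≥ A > 0`, and let `x` be real with
`∑ u, 2^(-x / a u) = 1/2`. Then for every real `L` with `0 ≤ L ≤ 2A`,
`∑ u, 2^(-(x + L) / a u) ≥ 1/8`. -/
theorem stmt_9 (m : ℕ) (A : ℝ) (hA : 0 < A) (a : Fin m → ℝ) (ha : ∀ u, A ≤ a u)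
    (x : ℝ) (hx : ∑ u, (2 : ℝ) ^ (-x / a u) = 1 / 2)
    (L : ℝ) (hL0 : 0 ≤ L) (hL1 : L ≤ 2 * A) :
    ∑ u, (2 : ℝ) ^ (-(x + L) / a u) ≥ 1 / 8 := by
  have key : ∀ u, (2 : ℝ) ^ (-x / a u) * (1 / 4) ≤ (2 : ℝ) ^ (-(x + L) / a u) := by
    intro u
    have hau : 0 < a u := hA.trans_le (ha u)
    have hL : L / a u ≤ 2 := by
      rw [div_le_iff₀ hau]
      linarith [ha u]
    have hquarter : (1 / 4 : ℝ) = (2 : ℝ) ^ (-2 : ℝ) := by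
      rw [Real.rpow_neg (by norm_num), Real.rpow_two]
      norm_num
    rw [hquarter, ← Real.rpow_add (by norm_num)]
    apply Real.rpow_le_rpow_of_exponent_le (by norm_num)
    rw [neg_add, add_div, neg_div (a u) L]
    linarith
  calc (1 / 8 : ℝ) = ∑ u, (2 : ℝ) ^ (-x / a u) * (1 / 4) := by
        rw [← Finset.sum_mul, hx]
        norm_num
    _ ≤ ∑ u, (2 : ℝ) ^ (-(x + L) / a u) := Finset.sum_le_sum fun u _ => key u
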